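/- Let μ ≥ 0 with μ ≠ 1/4, let d ≥ 1 and let R > 0. Then there exists C > 0 such that for all t ≥ 0 and ξ ∈ ℝ^d \ {0} with τ := (1+t)|ξ| ≤ R, one has |e_+(t,ξ)| ≤ C τ^{1/2 + Re ν}, |e_−(t,ξ)| ≤ C τ^{1/2 − Re ν}, |ė_+(t,ξ)| ≤ C |ξ| τ^{−1/2 + Re ν} and |ė_−(t,ξ)| ≤ C |ξ| τ^{−1/2 − Re ν}. -/

import Mathlib

open MeasureTheory Real Set

noncomputable section

/-- Bessel function of the first kind `J_ν(τ)`, defined by its power series,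
using the principal branch of `(τ/2)^(ν+2k)`. -/
def besselJ (ν : ℂ) (τ : ℝ) : ℂ :=
  ∑' k : ℕ, ((-1 : ℂ) ^ k / ((Nat.factorial k : ℂ) * Complex.Gamma (ν + k + 1))) *
    ((τ : ℂ) / 2) ^ (ν + 2 * (k : ℂ))

/-- Bessel function of the second kind (Neumann function) `Y_ν(τ)` for `ν ∉ ℤ`. -/
def besselY (ν : ℂ) (τ : ℝ) : ℂ :=
  (besselJ ν τ * Complex.cos (ν * (π : ℂ)) - besselJ (-ν) τ) / Complex.sin (ν * (π : ℂ))

/-- The index `ν` associated with the mass parameter `μ`. -/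
def nuOf (μ : ℝ) : ℂ :=
  if μ ≤ 1 / 4 then ((Real.sqrt (1 - 4 * μ) / 2 : ℝ) : ℂ)
  else Complex.I * ((Real.sqrt (4 * μ - 1) / 2 : ℝ) : ℂ)

/-- `e₊(t,ξ) = τ^{1/2} J_ν(τ)` with `τ = (1+t) r`, `r = |ξ|`. -/
def ePlus (ν : ℂ) (r t : ℝ) : ℂ :=
  (Real.sqrt ((1 + t) * r) : ℂ) * besselJ ν ((1 + t) * r)

/-- `e₋(t,ξ) = τ^{1/2} Y_ν(τ)` with `τ = (1+t) r`, `r = |ξ|`. -/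
def eMinus (ν : ℂ) (r t : ℝ) : ℂ :=
  (Real.sqrt ((1 + t) * r) : ℂ) * besselY ν ((1 + t) * r)

/-- `ė₊ = ∂ₜ e₊`. -/
def ePlusDot (ν : ℂ) (r t : ℝ) : ℂ := deriv (ePlus ν r) t

/-- `ė₋ = ∂ₜ e₋`. -/
def eMinusDot (ν : ℂ) (r t : ℝ) : ℂ := deriv (eMinus ν r) t

/-- The Fourier multiplier `E₀(t,t₀,ξ)` of the Klein–Gordon propagator. -/
def E0 (ν : ℂ) (r t t₀ : ℝ) : ℂ :=
  (ePlus ν r t * eMinusDot ν r t₀ - ePlusDot ν r t₀ * eMinus ν r t) /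
    (ePlus ν r t₀ * eMinusDot ν r t₀ - ePlusDot ν r t₀ * eMinus ν r t₀)

/-- The Fourier multiplier `E₁(t,t₀,ξ)` of the Klein–Gordon propagator. -/
def E1 (ν : ℂ) (r t t₀ : ℝ) : ℂ :=
  (ePlus ν r t₀ * eMinus ν r t - ePlus ν r t * eMinus ν r t₀) /
    (ePlus ν r t₀ * eMinusDot ν r t₀ - ePlusDot ν r t₀ * eMinus ν r t₀)

/-- `Ė₀ = ∂ₜ E₀` (derivative in the first time variable). -/
def E0dot (ν : ℂ) (r t t₀ : ℝ) : ℂ := deriv (fun s => E0 ν r s t₀) t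

/-- `Ė₁ = ∂ₜ E₁` (derivative in the first time variable). -/
def E1dot (ν : ℂ) (r t t₀ : ℝ) : ℂ := deriv (fun s => E1 ν r s t₀) t

/-- The Neumann function `Y₀(τ)` (logarithmic case `ν = 0`). -/
def besselY0 (τ : ℝ) : ℂ :=
  (2 / (π : ℂ)) * (Complex.log ((τ : ℂ) / 2) + (Real.eulerMascheroniConstant : ℂ)) * besselJ 0 τ +
    (2 / (π : ℂ)) * ∑' k : ℕ,
      ((-1 : ℂ) ^ ((k + 1) + 1) * ((harmonic (k + 1) : ℚ) : ℂ) /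
          ((Nat.factorial (k + 1) : ℂ)) ^ 2) * ((τ : ℂ) / 2) ^ (2 * (k + 1))

/-- `e₋(t,ξ) = τ^{1/2} Y₀(τ)` in the case `μ = 1/4`, `ν = 0`. -/
def eMinusZ (r t : ℝ) : ℂ :=
  (Real.sqrt ((1 + t) * r) : ℂ) * besselY0 ((1 + t) * r)

/-- `ė₋ = ∂ₜ e₋` in the case `μ = 1/4`. -/
def eMinusZDot (r t : ℝ) : ℂ := deriv (eMinusZ r) t

/-- `E₀(t,t₀,ξ)` in the case `μ = 1/4`, `ν = 0`. -/
def E0Z (r t t₀ : ℝ) : ℂ :=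
  (ePlus 0 r t * eMinusZDot r t₀ - ePlusDot 0 r t₀ * eMinusZ r t) /
    (ePlus 0 r t₀ * eMinusZDot r t₀ - ePlusDot 0 r t₀ * eMinusZ r t₀)

/-- `E₁(t,t₀,ξ)` in the case `μ = 1/4`, `ν = 0`. -/
def E1Z (r t t₀ : ℝ) : ℂ :=
  (ePlus 0 r t₀ * eMinusZ r t - ePlus 0 r t * eMinusZ r t₀) /
    (ePlus 0 r t₀ * eMinusZDot r t₀ - ePlusDot 0 r t₀ * eMinusZ r t₀)

/-- `Ė₀` in the case `μ = 1/4`. -/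
def E0Zdot (r t t₀ : ℝ) : ℂ := deriv (fun s => E0Z r s t₀) t

/-- `Ė₁` in the case `μ = 1/4`. -/
def E1Zdot (r t t₀ : ℝ) : ℂ := deriv (fun s => E1Z r s t₀) t


/-- The reciprocal Gamma function is bounded along `s, s + 1, s + 2, …`. -/
lemma exists_norm_Gamma_add_nat_inv_le (s : ℂ) :
    ∃ M : ℝ, ∀ k : ℕ, ‖(Complex.Gamma (s + k))⁻¹‖ ≤ M := by
  obtain ⟨N, hN⟩ := exists_nat_ge (‖s‖ + 1)
  have hstep : ∀ k : ℕ, N ≤ k →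
      ‖(Complex.Gamma (s + (k + 1 : ℕ)))⁻¹‖ ≤ ‖(Complex.Gamma (s + k))⁻¹‖ := by
    intro k hk
    have h1 : (1 : ℝ) ≤ ‖s + k‖ := by
      have h2 : ‖(k : ℂ)‖ ≤ ‖s + k‖ + ‖s‖ := by
        simpa using norm_sub_le (s + k) s
      rw [Complex.norm_natCast] at h2
      have h3 : (N : ℝ) ≤ k := by exact_mod_cast hk
      linarith
    rw [Complex.one_div_Gamma_eq_self_mul_one_div_Gamma_add_one (s + k), norm_mul]
    push_cast
    rw [← add_assoc]
    exact le_mul_of_one_le_left (norm_nonneg _) h1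
  refine ⟨∑ j ∈ Finset.range (N + 1), ‖(Complex.Gamma (s + j))⁻¹‖, fun k => ?_⟩
  have hsmall : ∀ k ≤ N, ‖(Complex.Gamma (s + k))⁻¹‖ ≤
      ∑ j ∈ Finset.range (N + 1), ‖(Complex.Gamma (s + j))⁻¹‖ := fun k hk =>
    Finset.single_le_sum (f := fun j : ℕ => ‖(Complex.Gamma (s + j))⁻¹‖)
      (fun _ _ => norm_nonneg _) (Finset.mem_range.2 (Nat.lt_succ_of_le hk))
  rcases le_total k N with hk | hk
  · exact hsmall k hk
  · induction k, hk using Nat.le_induction with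
    | base => exact hsmall N le_rfl
    | succ k hk ih => exact (hstep k hk).trans ih

/-- The entire function `F` with `J_ν(τ) = (τ/2)^ν F((τ/2)²)`. -/
def besselEntire (ν z : ℂ) : ℂ :=
  ∑' k : ℕ, ((-1 : ℂ) ^ k / ((Nat.factorial k : ℂ) * Complex.Gamma (ν + k + 1))) * z ^ k

lemma differentiable_besselEntire (ν : ℂ) : Differentiable ℂ (besselEntire ν) := by
  obtain ⟨M, hM⟩ := exists_norm_Gamma_add_nat_inv_le (ν + 1)
  intro z
  have hd : DifferentiableOn ℂ (besselEntire ν) (Metric.ball 0 (‖z‖ + 1)) := by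
    refine Complex.differentiableOn_tsum_of_summable_norm
      (u := fun k : ℕ => M * ((‖z‖ + 1) ^ k / (Nat.factorial k : ℝ)))
      ((Real.summable_pow_div_factorial _).mul_left M) (fun k => by fun_prop)
      Metric.isOpen_ball (fun k w hw => ?_)
    have hw' : ‖w‖ ≤ ‖z‖ + 1 := by simpa using (Metric.mem_ball.1 hw).le
    have hk := hM k
    rw [add_right_comm, norm_inv] at hk
    have hp : ‖w‖ ^ k ≤ (‖z‖ + 1) ^ k := by gcongr
    simp only [norm_mul, norm_div, norm_pow, norm_neg, norm_one, one_pow,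
      Complex.norm_natCast]
    calc 1 / ((Nat.factorial k : ℝ) * ‖Complex.Gamma (ν + k + 1)‖) * ‖w‖ ^ k
        = ‖Complex.Gamma (ν + k + 1)‖⁻¹ * (‖w‖ ^ k / (Nat.factorial k : ℝ)) := by
          rw [one_div, mul_inv]; ring
      _ ≤ M * ((‖z‖ + 1) ^ k / (Nat.factorial k : ℝ)) := by
          have hM0 : 0 ≤ M := (inv_nonneg.2 (norm_nonneg _)).trans hk
          gcongr
  exact hd.differentiableAt (Metric.isOpen_ball.mem_nhds (by simp))

lemma besselJ_eq_cpow_mul (ν : ℂ) {τ : ℝ} (hτ : 0 < τ) :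
    besselJ ν τ = (τ : ℂ) ^ ν * ((1 / 2 : ℂ) ^ ν * besselEntire ν (((τ : ℂ) / 2) ^ 2)) := by
  have h0 : (τ : ℂ) / 2 ≠ 0 := by
    simpa using hτ.ne'
  have h1 : ((τ : ℂ) / 2) ^ ν = (τ : ℂ) ^ ν * (1 / 2 : ℂ) ^ ν := by
    have h := Complex.mul_cpow_ofReal_nonneg hτ.le (by norm_num : (0 : ℝ) ≤ 1 / 2) ν
    push_cast at h
    rw [← h, mul_one_div]
  rw [← mul_assoc, ← h1, besselJ, besselEntire, ← tsum_mul_left]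
  refine tsum_congr fun k => ?_
  rw [Complex.cpow_add _ _ h0, ← pow_mul]
  have h2 : ((τ : ℂ) / 2) ^ (2 * (k : ℂ)) = ((τ : ℂ) / 2) ^ (2 * k) := by
    rw [← Complex.cpow_natCast]
    push_cast
    rfl
  rw [h2]
  ring

/-- Near zero, `√τ J_ν(τ)` behaves like `τ^(1/2 + ν)` together with its first derivative. -/
lemma exists_sqrt_mul_besselJ_bounds (ν : ℂ) (R : ℝ) :
    ∃ C > (0 : ℝ), ∀ τ : ℝ, 0 < τ → τ ≤ R →
      ‖(Real.sqrt τ : ℂ) * besselJ ν τ‖ ≤ C * τ ^ (1 / 2 + ν.re) ∧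
      ∃ D : ℂ, HasDerivAt (fun x : ℝ => (Real.sqrt x : ℂ) * besselJ ν x) D τ ∧
        ‖D‖ ≤ C * τ ^ (-(1 / 2) + ν.re) := by
  set H : ℂ → ℂ := fun z => (1 / 2 : ℂ) ^ ν * besselEntire ν ((z / 2) ^ 2) with hH
  have hHd : Differentiable ℂ H :=
    ((differentiable_besselEntire ν).comp (by fun_prop)).const_mul _
  have hHd' : Continuous (deriv H) :=
    (hHd.contDiff (n := 1)).continuous_deriv le_rfl
  obtain ⟨K, hK⟩ := (isCompact_closedBall (0 : ℂ) R).exists_bound_of_continuousOn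
    hHd.continuous.continuousOn
  obtain ⟨K', hK'⟩ := (isCompact_closedBall (0 : ℂ) R).exists_bound_of_continuousOn
    hHd'.continuousOn
  set a : ℂ := 1 / 2 + ν with ha
  have hare : a.re = 1 / 2 + ν.re := by simp [ha]
  have heq : ∀ x : ℝ, 0 < x → (Real.sqrt x : ℂ) * besselJ ν x = (x : ℂ) ^ a * H x := by
    intro x hx
    rw [besselJ_eq_cpow_mul ν hx, ha, Complex.cpow_add _ _ (by exact_mod_cast hx.ne'),
      Real.sqrt_eq_rpow, Complex.ofReal_cpow hx.le, mul_assoc]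
    push_cast
    rfl
  refine ⟨|K| + ‖a‖ * |K| + |R| * |K'| + 1, by positivity, fun τ hτ hτR => ?_⟩
  have hmem : (τ : ℂ) ∈ Metric.closedBall (0 : ℂ) R := by
    simpa [abs_of_pos hτ] using hτR
  have hK₁ : ‖H τ‖ ≤ |K| := (hK _ hmem).trans (le_abs_self K)
  have hK₂ : ‖deriv H τ‖ ≤ |K'| := (hK' _ hmem).trans (le_abs_self K')
  have hslit : (τ : ℂ) ∈ Complex.slitPlane := Complex.ofReal_mem_slitPlane.2 hτ
  refine ⟨?_, a * (τ : ℂ) ^ (a - 1) * H τ + (τ : ℂ) ^ a * deriv H τ, ?_, ?_⟩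
  · rw [heq τ hτ, norm_mul, Complex.norm_cpow_eq_rpow_re_of_pos hτ, hare, mul_comm]
    gcongr
    have : 0 ≤ ‖a‖ * |K| + |R| * |K'| + 1 := by positivity
    linarith
  · have h1 : HasDerivAt (fun z : ℂ => z ^ a * H z)
        (a * (τ : ℂ) ^ (a - 1) * H τ + (τ : ℂ) ^ a * deriv H τ) (τ : ℂ) :=
      (hasDerivAt_id (τ : ℂ)).cpow_const hslit |>.congr_deriv (by simp) |>.mul
        (hHd _).hasDerivAt
    exact h1.comp_ofReal.congr_of_eventuallyEq
      ((eventually_gt_nhds hτ).mono fun x hx => heq x hx)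
  · have hpow : τ ^ a.re = τ * τ ^ (a.re - 1) := by
      rw [Real.rpow_sub_one hτ.ne', mul_div_cancel₀ _ hτ.ne']
    have hexp : -(1 / 2) + ν.re = a.re - 1 := by rw [hare]; ring
    have hP : 0 ≤ τ ^ (a.re - 1) := by positivity
    rw [hexp]
    calc ‖a * (τ : ℂ) ^ (a - 1) * H τ + (τ : ℂ) ^ a * deriv H τ‖
        ≤ ‖a‖ * τ ^ (a.re - 1) * ‖H τ‖ + τ * τ ^ (a.re - 1) * ‖deriv H τ‖ := by
          refine (norm_add_le _ _).trans_eq ?_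
          simp only [norm_mul, Complex.norm_cpow_eq_rpow_re_of_pos hτ, Complex.sub_re,
            Complex.one_re, ← hpow]
      _ ≤ ‖a‖ * τ ^ (a.re - 1) * |K| + |R| * τ ^ (a.re - 1) * |K'| := by
          gcongr
          exact hτR.trans (le_abs_self R)
      _ = (‖a‖ * |K| + |R| * |K'|) * τ ^ (a.re - 1) := by ring
      _ ≤ (|K| + ‖a‖ * |K| + |R| * |K'| + 1) * τ ^ (a.re - 1) := by
          refine mul_le_mul_of_nonneg_right ?_ hP
          have := abs_nonneg K
          linarith

/-- Raising the exponent of a power on `(0, R]` costs only a constant. -/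
lemma rpow_add_le_mul_rpow {τ R p q : ℝ} (hτ : 0 < τ) (hτR : τ ≤ R) (hq : 0 ≤ q) :
    τ ^ (p + q) ≤ R ^ q * τ ^ p := by
  rw [Real.rpow_add hτ, mul_comm]
  gcongr

lemma nuOf_re_nonneg (μ : ℝ) : 0 ≤ (nuOf μ).re := by
  unfold nuOf
  split_ifs
  · rw [Complex.ofReal_re]
    positivity
  · simp

/-- for `μ ≥ 0`, `μ ≠ 1/4` and `R > 0` there is `C > 0` such that
for all `t ≥ 0`, `ξ ≠ 0` with `τ = (1+t)|ξ| ≤ R`: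
`|e₊| ≤ C τ^{1/2+Re ν}`, `|e₋| ≤ C τ^{1/2−Re ν}`, `|ė₊| ≤ C |ξ| τ^{−1/2+Re ν}`,
`|ė₋| ≤ C |ξ| τ^{−1/2−Re ν}`. -/
theorem stmt6 (μ : ℝ) (hμ : 0 ≤ μ) (hμ' : μ ≠ 1 / 4) (d : ℕ) (hd : 1 ≤ d)
    (R : ℝ) (hR : 0 < R) :
    ∃ C > (0 : ℝ), ∀ t : ℝ, 0 ≤ t →
      ∀ ξ : EuclideanSpace ℝ (Fin d), ξ ≠ 0 → (1 + t) * ‖ξ‖ ≤ R →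
        ‖ePlus (nuOf μ) ‖ξ‖ t‖ ≤ C * ((1 + t) * ‖ξ‖) ^ (1 / 2 + (nuOf μ).re) ∧
        ‖eMinus (nuOf μ) ‖ξ‖ t‖ ≤ C * ((1 + t) * ‖ξ‖) ^ (1 / 2 - (nuOf μ).re) ∧
        ‖ePlusDot (nuOf μ) ‖ξ‖ t‖ ≤ C * ‖ξ‖ * ((1 + t) * ‖ξ‖) ^ (-(1 / 2) + (nuOf μ).re) ∧
        ‖eMinusDot (nuOf μ) ‖ξ‖ t‖ ≤ C * ‖ξ‖ * ((1 + t) * ‖ξ‖) ^ (-(1 / 2) - (nuOf μ).re) := by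
  set ν := nuOf μ with hν
  have hre : 0 ≤ ν.re := nuOf_re_nonneg μ
  obtain ⟨A, hA, hJ⟩ := exists_sqrt_mul_besselJ_bounds ν R
  obtain ⟨B, hB, hJ'⟩ := exists_sqrt_mul_besselJ_bounds (-ν) R
  set c := Complex.cos (ν * (π : ℂ))
  set s := Complex.sin (ν * (π : ℂ))
  set Q := (A * R ^ (2 * ν.re) * ‖c‖ + B) / ‖s‖ with hQ
  have hQ0 : 0 ≤ Q := by positivity
  have combine : ∀ {x y : ℂ} {τ p : ℝ}, 0 < τ → τ ≤ R → ‖x‖ ≤ A * τ ^ (p + ν.re) →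
      ‖y‖ ≤ B * τ ^ (p + (-ν).re) → ‖(x * c - y) / s‖ ≤ Q * τ ^ (p - ν.re) := by
    intro x y τ p hτ hτR hx hy
    have h1 : τ ^ (p + ν.re) ≤ R ^ (2 * ν.re) * τ ^ (p - ν.re) := by
      have h := rpow_add_le_mul_rpow (p := p - ν.re) hτ hτR (by positivity : 0 ≤ 2 * ν.re)
      rwa [show p - ν.re + 2 * ν.re = p + ν.re by ring] at h
    rw [Complex.neg_re, ← sub_eq_add_neg] at hy
    have h2 : ‖x * c - y‖ ≤ (A * R ^ (2 * ν.re) * ‖c‖ + B) * τ ^ (p - ν.re) :=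
      calc ‖x * c - y‖ ≤ ‖x‖ * ‖c‖ + ‖y‖ := by
            simpa only [norm_mul] using norm_sub_le (x * c) y
        _ ≤ A * (R ^ (2 * ν.re) * τ ^ (p - ν.re)) * ‖c‖ + B * τ ^ (p - ν.re) := by
            gcongr
            exact hx.trans (by gcongr)
        _ = (A * R ^ (2 * ν.re) * ‖c‖ + B) * τ ^ (p - ν.re) := by ring
    rw [norm_div, hQ, div_mul_eq_mul_div]
    gcongr
  refine ⟨A + Q, by positivity, fun t ht ξ hξ hτR => ?_⟩
  have hr : 0 < ‖ξ‖ := norm_pos_iff.2 hξ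
  set r := ‖ξ‖
  have hτ : 0 < (1 + t) * r := by positivity
  obtain ⟨hp, D, hD, hDn⟩ := hJ _ hτ hτR
  obtain ⟨hm, E, hE, hEn⟩ := hJ' _ hτ hτR
  have hlin : HasDerivAt (fun x : ℝ => (1 + x) * r) r t := by
    simpa using ((hasDerivAt_id t).const_add 1).mul_const r
  have hplus : HasDerivAt (ePlus ν r) (r • D) t :=
    HasDerivAt.scomp (h := fun x : ℝ => (1 + x) * r) t hD hlin
  have hminus : HasDerivAt (eMinus ν r) (((r • D) * c - r • E) / s) t := by
    have h := ((hplus.mul_const c).sub (HasDerivAt.scomp (h := fun x : ℝ => (1 + x) * r) t hE hlin)).div_const s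
    refine h.congr_of_eventuallyEq (Filter.Eventually.of_forall fun x => ?_)
    simp only [eMinus, besselY, ePlus, Function.comp_apply, Pi.sub_apply]
    ring
  refine ⟨?_, ?_, ?_, ?_⟩
  · exact hp.trans (by gcongr; linarith)
  · have h := combine hτ hτR hp hm
    have he : eMinus ν r t = ((Real.sqrt ((1 + t) * r) : ℂ) * besselJ ν ((1 + t) * r) * c -
        (Real.sqrt ((1 + t) * r) : ℂ) * besselJ (-ν) ((1 + t) * r)) / s := by
      simp only [eMinus, besselY]
      ring
    rw [he]
    exact h.trans (by gcongr; linarith)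
  · rw [ePlusDot, hplus.deriv, norm_smul, Real.norm_of_nonneg hr.le, mul_comm (A + Q),
      mul_assoc]
    gcongr
    exact hDn.trans (by gcongr; linarith)
  · have h := combine hτ hτR hDn hEn
    have he : ((r • D) * c - r • E) / s = r • ((D * c - E) / s) := by
      simp only [Complex.real_smul]
      ring
    rw [eMinusDot, hminus.deriv, he, norm_smul, Real.norm_of_nonneg hr.le,
      mul_comm (A + Q), mul_assoc]
    gcongr
    exact h.trans (by gcongr; linarith)

end
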